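/- Let γ = 1 and let P be a complete solution of the bond pricing PDE. Then for all τ ∈ (0,T), (d/dτ) ∫₀^∞ r² P(τ,r)² dr ≤ K ∫₀^∞ r² P(τ,r)² dr with K = 3(2σ² − β). -/

import Mathlib

open Set MeasureTheory Real Filter Topology Asymptotics

noncomputable section

/-- Partial derivative of `P = P(τ,r)` with respect to `τ`. -/
def pTau (P : ℝ → ℝ → ℝ) (τ r : ℝ) : ℝ := deriv (fun t => P t r) τ

/-- Partial derivative of `P = P(τ,r)` with respect to `r`. -/
def pR (P : ℝ → ℝ → ℝ) (τ r : ℝ) : ℝ := deriv (fun x => P τ x) r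

/-- Second partial derivative of `P = P(τ,r)` with respect to `r`. -/
def pRR (P : ℝ → ℝ → ℝ) (τ r : ℝ) : ℝ := deriv (fun x => pR P τ x) r

/-- A complete solution of the bond pricing PDE
`-∂_τ P + (1/2) σ² r^{2γ} ∂²_r P + (α + β r) ∂_r P - r P = 0`
on `r > 0`, `τ ∈ (0,T)`, with initial condition `P(0,r) = 1`, continuous partial
derivatives on `[0,∞) × (0,T)` and the growth conditions
`|P(τ,r)| ≤ M e^{-m r^δ}`, `|∂_r P(τ,r)| ≤ M`. -/
structure IsCompleteSolution (σ α β γ T : ℝ) (P : ℝ → ℝ → ℝ) : Prop where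
  diff_tau : ∀ τ ∈ Ioo (0:ℝ) T, ∀ r ∈ Ici (0:ℝ), DifferentiableAt ℝ (fun t => P t r) τ
  diff_r : ∀ τ ∈ Ioo (0:ℝ) T, ∀ r ∈ Ici (0:ℝ), DifferentiableAt ℝ (fun x => P τ x) r
  diff_rr : ∀ τ ∈ Ioo (0:ℝ) T, ∀ r ∈ Ici (0:ℝ), DifferentiableAt ℝ (fun x => pR P τ x) r
  cont_tau : ContinuousOn (fun p : ℝ × ℝ => pTau P p.1 p.2) (Ioo 0 T ×ˢ Ici 0)
  cont_r : ContinuousOn (fun p : ℝ × ℝ => pR P p.1 p.2) (Ioo 0 T ×ˢ Ici 0)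
  cont_rr : ContinuousOn (fun p : ℝ × ℝ => pRR P p.1 p.2) (Ioo 0 T ×ˢ Ici 0)
  pde : ∀ τ ∈ Ioo (0:ℝ) T, ∀ r : ℝ, 0 < r →
      -pTau P τ r + (1/2) * σ^2 * r ^ (2*γ) * pRR P τ r
        + (α + β * r) * pR P τ r - r * P τ r = 0
  init : ∀ r : ℝ, 0 ≤ r → P 0 r = 1
  growth : ∃ M m δ : ℝ, 0 < M ∧ 0 < m ∧ 0 < δ ∧
      ∀ τ ∈ Ioo (0:ℝ) T, ∀ r : ℝ, 0 < r →
        |P τ r| ≤ M * Real.exp (-m * r ^ δ) ∧ |pR P τ r| ≤ M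

namespace IsCompleteSolution

variable {σ α β γ T : ℝ} {P : ℝ → ℝ → ℝ}

theorem hasDerivAt_tau (hP : IsCompleteSolution σ α β γ T P) {τ r : ℝ} (hτ : τ ∈ Ioo 0 T)
    (hr : 0 ≤ r) : HasDerivAt (fun t => P t r) (pTau P τ r) τ :=
  (hP.diff_tau τ hτ r hr).hasDerivAt

theorem hasDerivAt_r (hP : IsCompleteSolution σ α β γ T P) {τ r : ℝ} (hτ : τ ∈ Ioo 0 T)
    (hr : 0 ≤ r) : HasDerivAt (P τ) (pR P τ r) r :=
  (hP.diff_r τ hτ r hr).hasDerivAt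

theorem hasDerivAt_pR (hP : IsCompleteSolution σ α β γ T P) {τ r : ℝ} (hτ : τ ∈ Ioo 0 T)
    (hr : 0 ≤ r) : HasDerivAt (pR P τ) (pRR P τ r) r :=
  (hP.diff_rr τ hτ r hr).hasDerivAt

theorem continuousOn_slice (hP : IsCompleteSolution σ α β γ T P) {τ : ℝ} (hτ : τ ∈ Ioo 0 T) :
    ContinuousOn (P τ) (Ici 0) :=
  fun _ hr => (hP.hasDerivAt_r hτ hr).continuousAt.continuousWithinAt

theorem continuousOn_pR_slice (hP : IsCompleteSolution σ α β γ T P) {τ : ℝ}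
    (hτ : τ ∈ Ioo 0 T) : ContinuousOn (pR P τ) (Ici 0) :=
  fun _ hr => (hP.hasDerivAt_pR hτ hr).continuousAt.continuousWithinAt

theorem continuousOn_pRR_slice (hP : IsCompleteSolution σ α β γ T P) {τ : ℝ}
    (hτ : τ ∈ Ioo 0 T) : ContinuousOn (pRR P τ) (Ici 0) :=
  hP.cont_rr.comp (f := fun r => (τ, r)) (by fun_prop) fun _ hr => ⟨hτ, hr⟩

theorem continuousOn_pTau_slice (hP : IsCompleteSolution σ α β γ T P) {τ : ℝ}
    (hτ : τ ∈ Ioo 0 T) : ContinuousOn (pTau P τ) (Ici 0) :=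
  hP.cont_tau.comp (f := fun r => (τ, r)) (by fun_prop) fun _ hr => ⟨hτ, hr⟩

theorem continuousAt_pR_tau (hP : IsCompleteSolution σ α β γ T P) {τ r : ℝ}
    (hτ : τ ∈ Ioo 0 T) (hr : 0 ≤ r) : ContinuousAt (fun t => pR P t r) τ :=
  (hP.cont_r.comp (f := fun t => (t, r)) (s := Ioo 0 T) (by fun_prop)
    fun _ ht => ⟨ht, hr⟩).continuousAt (isOpen_Ioo.mem_nhds hτ)

theorem continuousAt_pRR_tau (hP : IsCompleteSolution σ α β γ T P) {τ r : ℝ}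
    (hτ : τ ∈ Ioo 0 T) (hr : 0 ≤ r) : ContinuousAt (fun t => pRR P t r) τ :=
  (hP.cont_rr.comp (f := fun t => (t, r)) (s := Ioo 0 T) (by fun_prop)
    fun _ ht => ⟨ht, hr⟩).continuousAt (isOpen_Ioo.mem_nhds hτ)

theorem exists_local_bound (hP : IsCompleteSolution σ α β γ T P) {τ a b : ℝ}
    (hτ : τ ∈ Ioo 0 T) (ha : 0 ≤ a) :
    ∃ ε > 0, ∃ C, 0 ≤ C ∧ Metric.ball τ ε ⊆ Ioo 0 T ∧ ∀ t ∈ Metric.ball τ ε, ∀ r ∈ Icc a b,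
      |pTau P t r| ≤ C ∧ |pR P t r| ≤ C ∧ |pRR P t r| ≤ C := by
  obtain ⟨ε, hε, hsub⟩ := Metric.nhds_basis_closedBall.mem_iff.1 (isOpen_Ioo.mem_nhds hτ)
  have hK : IsCompact (Metric.closedBall τ ε ×ˢ Icc a b) :=
    (isCompact_closedBall τ ε).prod isCompact_Icc
  have hKs : Metric.closedBall τ ε ×ˢ Icc a b ⊆ Ioo 0 T ×ˢ Ici 0 :=
    prod_mono hsub fun x hx => ha.trans hx.1
  obtain ⟨C₁, h₁⟩ := hK.exists_bound_of_continuousOn (hP.cont_tau.mono hKs)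
  obtain ⟨C₂, h₂⟩ := hK.exists_bound_of_continuousOn (hP.cont_r.mono hKs)
  obtain ⟨C₃, h₃⟩ := hK.exists_bound_of_continuousOn (hP.cont_rr.mono hKs)
  refine ⟨ε, hε, max 0 (max C₁ (max C₂ C₃)), le_max_left _ _,
    Metric.ball_subset_closedBall.trans hsub, fun t ht r hr => ?_⟩
  have hm : (t, r) ∈ Metric.closedBall τ ε ×ˢ Icc a b := ⟨Metric.ball_subset_closedBall ht, hr⟩
  exact ⟨(h₁ _ hm).trans (by simp), (h₂ _ hm).trans (by simp), (h₃ _ hm).trans (by simp)⟩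

theorem pow_mul_exp_neg_rpow_bounded {m δ : ℝ} (hm : 0 < m) (hδ : 0 < δ) (k : ℕ) :
    ∃ C, ∀ r : ℝ, 1 ≤ r → r ^ k * Real.exp (-m * r ^ δ) ≤ C := by
  obtain ⟨n, hn⟩ := exists_nat_ge ((k : ℝ) / δ)
  refine ⟨n.factorial / m ^ n, fun r hr => ?_⟩
  have hr0 : 0 < r := by linarith
  have h₁ : r ^ k ≤ (r ^ δ) ^ n := by
    rw [← Real.rpow_natCast, ← Real.rpow_natCast, ← Real.rpow_mul hr0.le]
    exact Real.rpow_le_rpow_of_exponent_le hr (by rw [div_le_iff₀ hδ] at hn; linarith)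
  have h₂ := Real.pow_div_factorial_le_exp (m * r ^ δ) (by positivity) n
  rw [div_le_iff₀ (by positivity), mul_pow] at h₂
  rw [neg_mul, Real.exp_neg, ← div_eq_mul_inv, div_le_div_iff₀ (by positivity) (by positivity)]
  calc r ^ k * m ^ n ≤ (r ^ δ) ^ n * m ^ n := by gcongr
    _ ≤ _ := by linarith

/-- The growth condition gives polynomial decay of the order needed for the tail estimates. -/
theorem exists_decay (hP : IsCompleteSolution σ α β γ T P) :
    ∃ C, 0 ≤ C ∧ ∀ t ∈ Ioo 0 T, ∀ r, 0 < r →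
      |P t r| ≤ C ∧ r ^ 8 * |P t r| ≤ C ∧ |pR P t r| ≤ C := by
  obtain ⟨M, m, δ, hM, hm, hδ, h⟩ := hP.growth
  obtain ⟨C, hC⟩ := pow_mul_exp_neg_rpow_bounded hm hδ 8
  refine ⟨max M (M * C), hM.le.trans (le_max_left _ _), fun t ht r hr => ?_⟩
  obtain ⟨h₁, h₂⟩ := h t ht r hr
  have h₃ : |P t r| ≤ M := h₁.trans <| mul_le_of_le_one_right hM.le <|
    Real.exp_le_one_iff.2 (by have : 0 < r ^ δ := by positivity
                              nlinarith)
  refine ⟨h₃.trans (le_max_left _ _), ?_, h₂.trans (le_max_left _ _)⟩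
  rcases le_total r 1 with hr1 | hr1
  · exact ((mul_le_of_le_one_left (abs_nonneg _) (pow_le_one₀ hr.le hr1)).trans h₃).trans
      (le_max_left _ _)
  · calc r ^ 8 * |P t r| ≤ r ^ 8 * (M * Real.exp (-m * r ^ δ)) := by gcongr
      _ = M * (r ^ 8 * Real.exp (-m * r ^ δ)) := by ring
      _ ≤ M * C := by gcongr; exact hC r hr1
      _ ≤ _ := le_max_right _ _

theorem hasDerivAt_integral_sq (hP : IsCompleteSolution σ α β γ T P) {τ a b : ℝ}
    (hτ : τ ∈ Ioo 0 T) (ha : 0 ≤ a) (hab : a ≤ b) {w : ℝ → ℝ} (hw : Continuous w) :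
    HasDerivAt (fun t => ∫ r in a..b, w r * P t r ^ 2)
      (∫ r in a..b, w r * (2 * P τ r * pTau P τ r)) τ := by
  obtain ⟨ε, hε, C, hC, hsub, hb⟩ := hP.exists_local_bound (b := b) hτ ha
  obtain ⟨M, hM, hdec⟩ := hP.exists_decay
  have hIcc : uIcc a b ⊆ Ici 0 := by
    rw [uIcc_of_le hab]; exact fun x hx => ha.trans hx.1
  have hc : ∀ t ∈ Ioo 0 T, ContinuousOn (fun r => w r * P t r ^ 2) (uIcc a b) := fun t ht =>
    hw.continuousOn.mul (((hP.continuousOn_slice ht).mono hIcc).pow 2)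
  have hc' : ContinuousOn (fun r => w r * (2 * P τ r * pTau P τ r)) (uIcc a b) :=
    hw.continuousOn.mul ((continuousOn_const.mul ((hP.continuousOn_slice hτ).mono hIcc)).mul
      ((hP.continuousOn_pTau_slice hτ).mono hIcc))
  refine (intervalIntegral.hasDerivAt_integral_of_dominated_loc_of_deriv_le
    (bound := fun r => |w r| * (2 * M * C)) (F' := fun t r => w r * (2 * P t r * pTau P t r))
    (Metric.ball_mem_nhds τ hε) ?_ (hc τ hτ).intervalIntegrable ?_ ?_ ?_ ?_).2
  · filter_upwards [Metric.ball_mem_nhds τ hε] with t ht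
    exact ((hc t (hsub ht)).mono uIoc_subset_uIcc).aestronglyMeasurable measurableSet_uIoc
  · exact (hc'.mono uIoc_subset_uIcc).aestronglyMeasurable measurableSet_uIoc
  · refine Eventually.of_forall fun r hr t ht => ?_
    rw [uIoc_of_le hab] at hr
    have h₁ := (hdec t (hsub ht) r (ha.trans_lt hr.1)).1
    have h₂ := (hb t ht r (Ioc_subset_Icc_self hr)).1
    rw [Real.norm_eq_abs, abs_mul, abs_mul, abs_mul, abs_two]
    gcongr
  · exact (hw.abs.mul continuous_const).intervalIntegrable _ _
  · refine Eventually.of_forall fun r hr t ht => ?_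
    rw [uIoc_of_le hab] at hr
    convert! ((hP.hasDerivAt_tau (hsub ht) (ha.trans hr.1.le)).fun_pow 2).const_mul (w r) using 1
    ring

/-- The weighted Dirichlet energy is differentiable in `τ` although `∂_τ ∂_r P` need not exist. -/
theorem hasDerivAt_integral_pR_sq (hP : IsCompleteSolution σ α β γ T P) {τ a b : ℝ}
    (hτ : τ ∈ Ioo 0 T) (ha : 0 ≤ a) (hab : a ≤ b) {φ φ' : ℝ → ℝ}
    (hφ : ∀ r, HasDerivAt φ (φ' r) r) (hφ' : Continuous φ') (hφa : φ a = 0) (hφb : φ b = 0) :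
    HasDerivAt (fun t => ∫ r in a..b, φ r * pR P t r ^ 2)
      (∫ r in a..b, -pTau P τ r * (2 * φ' r * pR P τ r + 2 * φ r * pRR P τ r)) τ := by
  obtain ⟨ε, hε, C, hC, hsub, hb⟩ := hP.exists_local_bound (b := b) hτ ha
  have hφc : Continuous φ := continuous_iff_continuousAt.2 fun r => (hφ r).continuousAt
  have hIcc : uIcc a b ⊆ Ici 0 := by
    rw [uIcc_of_le hab]; exact fun x hx => ha.trans hx.1
  have c0 : ∀ t ∈ Ioo 0 T, ContinuousOn (P t) (uIcc a b) := fun t ht =>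
    (hP.continuousOn_slice ht).mono hIcc
  have c1 : ∀ t ∈ Ioo 0 T, ContinuousOn (pR P t) (uIcc a b) := fun t ht =>
    (hP.continuousOn_pR_slice ht).mono hIcc
  have c2 : ∀ t ∈ Ioo 0 T, ContinuousOn (pRR P t) (uIcc a b) := fun t ht =>
    (hP.continuousOn_pRR_slice ht).mono hIcc
  have hφo := hφc.continuousOn (s := uIcc a b)
  have hφo' := hφ'.continuousOn (s := uIcc a b)
  rw [hasDerivAt_iff_tendsto_slope]
  have hball : ∀ᶠ t in 𝓝[≠] τ, t ∈ Metric.ball τ ε ∧ t ≠ τ :=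
    (eventually_nhdsWithin_of_eventually_nhds (Metric.ball_mem_nhds τ hε)).and
      eventually_mem_nhdsWithin
  have hslope : ∀ t ∈ Ioo 0 T, slope (fun t => ∫ r in a..b, φ r * pR P t r ^ 2) τ t =
      ∫ r in a..b, -slope (fun t => P t r) τ t * (φ' r * (pR P t r + pR P τ r)
        + φ r * (pRR P t r + pRR P τ r)) := by
    intro t ht
    have hparts := intervalIntegral.integral_mul_deriv_eq_deriv_mul_of_hasDerivAt
      (a := a) (b := b) (u := fun r => φ r * (pR P t r + pR P τ r)) (v := fun r => P t r - P τ r)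
      (u' := fun r => φ' r * (pR P t r + pR P τ r) + φ r * (pRR P t r + pRR P τ r))
      (v' := fun r => pR P t r - pR P τ r)
      (hφo.mul ((c1 t ht).add (c1 τ hτ))) ((c0 t ht).sub (c0 τ hτ))
      (fun r hr => by
        have hr0 : 0 ≤ r := by rw [min_eq_left hab] at hr; exact ha.trans hr.1.le
        exact (hφ r).mul ((hP.hasDerivAt_pR ht hr0).add (hP.hasDerivAt_pR hτ hr0)))
      (fun r hr => by
        have hr0 : 0 ≤ r := by rw [min_eq_left hab] at hr; exact ha.trans hr.1.le
        exact (hP.hasDerivAt_r ht hr0).sub (hP.hasDerivAt_r hτ hr0))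
      ((hφo'.mul ((c1 t ht).add (c1 τ hτ))).add
        (hφo.mul ((c2 t ht).add (c2 τ hτ)))).intervalIntegrable
      ((c1 t ht).sub (c1 τ hτ)).intervalIntegrable
    rw [slope_def_field, ← intervalIntegral.integral_sub (μ := volume) (f := fun r => φ r * pR P t r ^ 2)
      (g := fun r => φ r * pR P τ r ^ 2)
      (ContinuousOn.intervalIntegrable (hφo.mul ((c1 t ht).pow 2)))
      (ContinuousOn.intervalIntegrable (hφo.mul ((c1 τ hτ).pow 2)))]
    have e₁ : ∫ r in a..b, (φ r * pR P t r ^ 2 - φ r * pR P τ r ^ 2) =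
        ∫ r in a..b, φ r * (pR P t r + pR P τ r) * (pR P t r - pR P τ r) := by
      congr 1; ext r; ring
    rw [e₁, hparts, hφa, hφb, zero_mul, zero_mul, zero_mul, zero_mul, sub_zero, zero_sub, neg_div,
      ← intervalIntegral.integral_div, ← intervalIntegral.integral_neg]
    congr 1; ext r
    rw [slope_def_field]; ring
  refine Tendsto.congr' (f₁ := fun t => ∫ r in a..b, -slope (fun t => P t r) τ t *
    (φ' r * (pR P t r + pR P τ r) + φ r * (pRR P t r + pRR P τ r))) ?_ ?_
  · filter_upwards [hball] with t ht using (hslope t (hsub ht.1)).symm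
  refine intervalIntegral.tendsto_integral_filter_of_dominated_convergence
    (fun r => C * (|φ' r| * (C + C) + |φ r| * (C + C))) ?_ ?_ ?_ ?_
  · filter_upwards [hball] with t ht
    have ht' := hsub ht.1
    refine ContinuousOn.aestronglyMeasurable ?_ measurableSet_uIoc
    refine ContinuousOn.mono ?_ uIoc_subset_uIcc
    simp only [slope_def_field]
    exact (((c0 t ht').sub (c0 τ hτ)).div_const _).neg.mul
      ((hφo'.mul ((c1 t ht').add (c1 τ hτ))).add (hφo.mul ((c2 t ht').add (c2 τ hτ))))
  · filter_upwards [hball] with t ht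
    refine Eventually.of_forall fun r hr => ?_
    rw [uIoc_of_le hab] at hr
    have hr' := Ioc_subset_Icc_self hr
    have hτb : τ ∈ Metric.ball τ ε := Metric.mem_ball_self hε
    have hs : |slope (fun t => P t r) τ t| ≤ C := by
      have := Convex.norm_image_sub_le_of_norm_hasDerivWithin_le (f := fun t => P t r)
        (fun s hs => (hP.hasDerivAt_tau (hsub hs) (ha.trans hr'.1)).hasDerivWithinAt)
        (fun s hs => (hb s hs r hr').1) (convex_ball τ ε) hτb ht.1
      rw [slope_def_field, abs_div, div_le_iff₀ (abs_pos.2 (sub_ne_zero.2 ht.2))]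
      exact this
    have b₁ := hb t ht.1 r hr'
    have b₂ := hb τ hτb r hr'
    rw [Real.norm_eq_abs, abs_mul, abs_neg]
    refine mul_le_mul hs ((abs_add_le _ _).trans ?_) (abs_nonneg _) hC
    rw [abs_mul, abs_mul]
    gcongr
    · exact (abs_add_le _ _).trans (add_le_add b₁.2.1 b₂.2.1)
    · exact (abs_add_le _ _).trans (add_le_add b₁.2.2 b₂.2.2)
  · exact Continuous.intervalIntegrable (by fun_prop) _ _
  · refine Eventually.of_forall fun r hr => ?_
    rw [uIoc_of_le hab] at hr
    have hr0 : 0 ≤ r := ha.trans hr.1.le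
    have l₀ := hasDerivAt_iff_tendsto_slope.1 (hP.hasDerivAt_tau hτ hr0)
    have l₁ := (hP.continuousAt_pR_tau hτ hr0).tendsto.mono_left
      (nhdsWithin_le_nhds (s := {τ}ᶜ))
    have l₂ := (hP.continuousAt_pRR_tau hτ hr0).tendsto.mono_left
      (nhdsWithin_le_nhds (s := {τ}ᶜ))
    convert l₀.neg.mul (((l₁.add_const (pR P τ r)).const_mul (φ' r)).add
      ((l₂.add_const (pRR P τ r)).const_mul (φ r))) using 2
    ring

theorem pTau_eq (hP : IsCompleteSolution σ α β 1 T P) {τ r : ℝ} (hτ : τ ∈ Ioo 0 T)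
    (hr : 0 < r) : pTau P τ r =
      1 / 2 * σ ^ 2 * r ^ 2 * pRR P τ r + (α + β * r) * pR P τ r - r * P τ r := by
  have h := hP.pde τ hτ r hr
  rw [mul_one, Real.rpow_two] at h
  linarith

theorem continuousOn_uIcc (hP : IsCompleteSolution σ α β γ T P) {τ a b : ℝ} (hτ : τ ∈ Ioo 0 T)
    (ha : 0 ≤ a) (hab : a ≤ b) :
    ContinuousOn (P τ) (uIcc a b) ∧ ContinuousOn (pR P τ) (uIcc a b) ∧
      ContinuousOn (pRR P τ) (uIcc a b) ∧ ContinuousOn (pTau P τ) (uIcc a b) := by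
  have hIcc : uIcc a b ⊆ Ici 0 := by
    rw [uIcc_of_le hab]; exact fun x hx => ha.trans hx.1
  exact ⟨(hP.continuousOn_slice hτ).mono hIcc, (hP.continuousOn_pR_slice hτ).mono hIcc,
    (hP.continuousOn_pRR_slice hτ).mono hIcc, (hP.continuousOn_pTau_slice hτ).mono hIcc⟩

end IsCompleteSolution

/-- The boundary term produced by integrating `2 r² P ∂_τ P` by parts. -/
def energyFlux (σ α β : ℝ) (P : ℝ → ℝ → ℝ) (τ r : ℝ) : ℝ :=
  σ ^ 2 * r ^ 4 * P τ r * pR P τ r - 2 * σ ^ 2 * r ^ 3 * P τ r ^ 2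
    + (α + β * r) * r ^ 2 * P τ r ^ 2

/-- The integrand left after integrating `2 r² P ∂_τ P` by parts. -/
def energyDensity (σ α β : ℝ) (P : ℝ → ℝ → ℝ) (τ r : ℝ) : ℝ :=
  (6 * σ ^ 2 - 3 * β) * (r ^ 2 * P τ r ^ 2) - σ ^ 2 * r ^ 4 * pR P τ r ^ 2
    - 2 * α * r * P τ r ^ 2 - 2 * r ^ 3 * P τ r ^ 2

namespace IsCompleteSolution

variable {σ α β γ T : ℝ} {P : ℝ → ℝ → ℝ}

theorem integral_energy_parts (hP : IsCompleteSolution σ α β 1 T P) {τ a b : ℝ}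
    (hτ : τ ∈ Ioo 0 T) (ha : 0 ≤ a) (hab : a ≤ b) :
    ∫ r in a..b, r ^ 2 * (2 * P τ r * pTau P τ r) =
      energyFlux σ α β P τ b - energyFlux σ α β P τ a
        + ∫ r in a..b, energyDensity σ α β P τ r := by
  obtain ⟨c0, c1, c2, c3⟩ := hP.continuousOn_uIcc hτ ha hab
  have i₁ : IntervalIntegrable (fun r => r ^ 2 * (2 * P τ r * pTau P τ r)) volume a b :=
    ContinuousOn.intervalIntegrable (by fun_prop)
  have i₂ : IntervalIntegrable (energyDensity σ α β P τ) volume a b :=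
    ContinuousOn.intervalIntegrable (by unfold energyDensity; fun_prop)
  rw [← sub_eq_iff_eq_add, ← intervalIntegral.integral_sub i₁ i₂]
  refine intervalIntegral.integral_eq_sub_of_hasDerivAt_of_le hab ?_ (fun r hr => ?_) (i₁.sub i₂)
  · rw [← uIcc_of_le hab]; unfold energyFlux; fun_prop
  · have hr0 : 0 < r := ha.trans_lt hr.1
    have d0 := hP.hasDerivAt_r hτ hr0.le
    have d1 := hP.hasDerivAt_pR hτ hr0.le
    have d := ((((hasDerivAt_pow 4 r).const_mul (σ ^ 2)).mul d0).mul d1).sub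
      (((hasDerivAt_pow 3 r).const_mul (2 * σ ^ 2)).mul (d0.fun_pow 2)) |>.add
      (((((hasDerivAt_id r).const_mul β).const_add α).mul (hasDerivAt_pow 2 r)).mul
        (d0.fun_pow 2))
    convert! d using 1
    rw [hP.pTau_eq hτ hr0]
    simp only [energyDensity, id, Pi.mul_apply]
    push_cast
    ring

theorem integral_sq_parts_le (hP : IsCompleteSolution σ α β 1 T P) (hσ : 0 < σ) (hα : 0 < α)
    {τ a b : ℝ} (hτ : τ ∈ Ioo 0 T) (ha : 1 ≤ a) (hab : a ≤ b) :
    ∫ r in a..b, 1 * (2 * P τ r * pTau P τ r) ≤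
      σ ^ 2 * b ^ 2 * P τ b * pR P τ b - σ ^ 2 * a ^ 2 * P τ a * pR P τ a
        + ∫ r in a..b, (2 * (α + |β| + σ ^ 2) ^ 2 / σ ^ 2 * P τ r ^ 2
          - 1 / 2 * σ ^ 2 * r ^ 2 * pR P τ r ^ 2) := by
  obtain ⟨c0, c1, c2, c3⟩ := hP.continuousOn_uIcc hτ (by linarith) hab
  have hparts : ∫ r in a..b, (2 * σ ^ 2 * r * P τ r * pR P τ r + σ ^ 2 * r ^ 2 * pR P τ r ^ 2
      + σ ^ 2 * r ^ 2 * P τ r * pRR P τ r) =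
      σ ^ 2 * b ^ 2 * P τ b * pR P τ b - σ ^ 2 * a ^ 2 * P τ a * pR P τ a := by
    refine intervalIntegral.integral_eq_sub_of_hasDerivAt_of_le
      (f := fun r => σ ^ 2 * r ^ 2 * P τ r * pR P τ r) hab ?_ (fun r hr => ?_)
      (ContinuousOn.intervalIntegrable (by fun_prop))
    · rw [← uIcc_of_le hab]; fun_prop
    · have hr0 : 0 < r := by linarith [hr.1]
      have d0 := hP.hasDerivAt_r hτ hr0.le
      have d1 := hP.hasDerivAt_pR hτ hr0.le
      convert! (((hasDerivAt_pow 2 r).const_mul (σ ^ 2)).mul d0).mul d1 using 1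
      simp only [Pi.mul_apply]
      push_cast
      ring
  rw [← hparts, ← intervalIntegral.integral_add
    (ContinuousOn.intervalIntegrable (by fun_prop)) (ContinuousOn.intervalIntegrable (by fun_prop))]
  refine intervalIntegral.integral_mono_on hab (ContinuousOn.intervalIntegrable (by fun_prop))
    (ContinuousOn.intervalIntegrable (by fun_prop)) fun r hr => ?_
  have hr1 : 1 ≤ r := ha.trans hr.1
  rw [hP.pTau_eq hτ (by linarith)]
  generalize P τ r = u
  generalize pR P τ r = p
  generalize pRR P τ r = q
  set k := α + |β| + σ ^ 2 with hk
  have hk0 : 0 < k := by positivity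
  have hB : |α + β * r - σ ^ 2 * r| ≤ k * r := by
    have h₁ := mul_le_mul_of_nonneg_right (neg_abs_le β) (by linarith : (0 : ℝ) ≤ r)
    have h₂ := mul_le_mul_of_nonneg_right (le_abs_self β) (by linarith : (0 : ℝ) ≤ r)
    have h₃ := mul_le_mul_of_nonneg_left hr1 hα.le
    have h₄ : 0 ≤ σ ^ 2 * r := by positivity
    rw [abs_le, hk]
    constructor <;> nlinarith
  have hB' : (α + β * r - σ ^ 2 * r) * (u * p) ≤ k * r * (|u| * |p|) := by
    rw [← abs_mul]
    refine (le_abs_self _).trans ?_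
    rw [abs_mul]
    gcongr
  have hsq : 2 * (k * r * (|u| * |p|)) ≤
      2 * k ^ 2 / σ ^ 2 * u ^ 2 + 1 / 2 * σ ^ 2 * r ^ 2 * p ^ 2 := by
    rw [← sq_abs u, ← sq_abs p]
    have : 2 * k ^ 2 / σ ^ 2 * |u| ^ 2 + 1 / 2 * σ ^ 2 * r ^ 2 * |p| ^ 2
        - 2 * (k * r * (|u| * |p|)) = (2 * k / σ * |u| - σ * r * |p|) ^ 2 / 2 := by
      field_simp; ring
    nlinarith [sq_nonneg (2 * k / σ * |u| - σ * r * |p|)]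
  have hu : 0 ≤ r * u ^ 2 := by have := sq_nonneg u; nlinarith
  nlinarith

theorem dirichlet_integrand_le {σ α β k r u p q x x' : ℝ} (hσ : 0 < σ) (hα : 0 < α)
    (hk : k = α + |β|) (hr1 : 1 ≤ r) (e : |x| ≤ 3) (e' : |x'| ≤ 3) :
    -(1 / 2 * σ ^ 2 * r ^ 2 * q + (α + β * r) * p - r * u) *
      (2 * (2 * x * x') * p + 2 * x ^ 2 * q) ≤
    (18 * ((k + σ ^ 2) ^ 2 + 1) / σ ^ 2 + 36 * (k + 1)) * r ^ 2 * (p ^ 2 + u ^ 2) := by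
  have hk0 : 0 < k := by rw [hk]; positivity
  have hB : |α + β * r| ≤ k * r := by
    have h₁ := mul_le_mul_of_nonneg_right (neg_abs_le β) (by linarith : (0 : ℝ) ≤ r)
    have h₂ := mul_le_mul_of_nonneg_right (le_abs_self β) (by linarith : (0 : ℝ) ≤ r)
    have h₃ := mul_le_mul_of_nonneg_left hr1 hα.le
    rw [abs_le, hk]
    constructor <;> nlinarith
  have hL : |(α + β * r) * p - r * u| ≤ r * (k * |p| + |u|) := by
    refine (abs_sub _ _).trans ?_
    rw [abs_mul, abs_mul, abs_of_pos (by linarith : 0 < r)]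
    nlinarith [mul_le_mul_of_nonneg_right hB (abs_nonneg p)]
  set L := (α + β * r) * p - r * u with hLdef
  set Y := 2 * x * L + 2 * σ ^ 2 * r ^ 2 * x' * p with hY
  have hYle : |Y| ≤ 6 * r ^ 2 * ((k + σ ^ 2) * |p| + |u|) := by
    have h₁ : |2 * x * L| ≤ 2 * 3 * (r * (k * |p| + |u|)) := by
      rw [abs_mul, abs_mul, abs_two]; gcongr
    have h₂ : |2 * σ ^ 2 * r ^ 2 * x' * p| ≤ 2 * σ ^ 2 * r ^ 2 * 3 * |p| := by
      rw [abs_mul, abs_mul, abs_of_nonneg (by positivity : 0 ≤ 2 * σ ^ 2 * r ^ 2)]; gcongr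
    have h₃ : r * (k * |p| + |u|) ≤ r ^ 2 * (k * |p| + |u|) := by
      gcongr; nlinarith
    have := (abs_add_le (2 * x * L) (2 * σ ^ 2 * r ^ 2 * x' * p))
    rw [hY]; nlinarith
  have hYsq : Y ^ 2 / (4 * σ ^ 2 * r ^ 2) ≤
      18 * ((k + σ ^ 2) ^ 2 + 1) / σ ^ 2 * r ^ 2 * (p ^ 2 + u ^ 2) := by
    rw [div_le_iff₀ (by positivity)]
    have h₁ : Y ^ 2 ≤ (6 * r ^ 2 * ((k + σ ^ 2) * |p| + |u|)) ^ 2 := by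
      rw [← sq_abs Y]; gcongr
    have h₂ : ((k + σ ^ 2) * |p| + |u|) ^ 2 ≤ 2 * ((k + σ ^ 2) ^ 2 + 1) * (p ^ 2 + u ^ 2) := by
      rw [← sq_abs p, ← sq_abs u]
      nlinarith [sq_nonneg ((k + σ ^ 2) * |p| - |u|), sq_nonneg ((k + σ ^ 2) * |u|),
        sq_nonneg (|p|)]
    have h₃ : 18 * ((k + σ ^ 2) ^ 2 + 1) / σ ^ 2 * r ^ 2 * (p ^ 2 + u ^ 2) * (4 * σ ^ 2 * r ^ 2) =
        36 * r ^ 4 * (2 * ((k + σ ^ 2) ^ 2 + 1) * (p ^ 2 + u ^ 2)) := by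
      field_simp; ring
    rw [h₃]
    calc Y ^ 2 ≤ 36 * r ^ 4 * ((k + σ ^ 2) * |p| + |u|) ^ 2 := by linarith
      _ ≤ _ := by gcongr
  have hcross : -(4 * x * x' * p * L) ≤ 36 * (k + 1) * r ^ 2 * (p ^ 2 + u ^ 2) := by
    have h₁ : -(4 * x * x' * p * L) ≤ 4 * 3 * 3 * |p| * (r * (k * |p| + |u|)) := by
      refine (neg_le_abs _).trans ?_
      rw [abs_mul, abs_mul, abs_mul, abs_mul, abs_of_pos (by norm_num : (0 : ℝ) < 4)]
      gcongr
    have h₂ : |p| * (k * |p| + |u|) ≤ (k + 1) * (p ^ 2 + u ^ 2) := by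
      rw [← sq_abs p, ← sq_abs u]
      nlinarith [sq_nonneg (|p| - |u|), sq_nonneg (|p|), mul_nonneg hk0.le (sq_nonneg (|u|))]
    calc _ ≤ 36 * r * (|p| * (k * |p| + |u|)) := by linarith
      _ ≤ 36 * r * ((k + 1) * (p ^ 2 + u ^ 2)) := by gcongr
      _ ≤ 36 * r ^ 2 * ((k + 1) * (p ^ 2 + u ^ 2)) := by gcongr; nlinarith
      _ = _ := by ring
  have hquad : -(σ ^ 2 * r ^ 2 * (x * q) ^ 2) - x * q * Y ≤ Y ^ 2 / (4 * σ ^ 2 * r ^ 2) := by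
    have : Y ^ 2 / (4 * σ ^ 2 * r ^ 2) + σ ^ 2 * r ^ 2 * (x * q) ^ 2 + x * q * Y =
        (Y / (2 * σ * r) + σ * r * (x * q)) ^ 2 := by
      field_simp; ring
    nlinarith [sq_nonneg (Y / (2 * σ * r) + σ * r * (x * q))]
  have key : -(1 / 2 * σ ^ 2 * r ^ 2 * q + (α + β * r) * p - r * u) *
      (2 * (2 * x * x') * p + 2 * x ^ 2 * q) =
      -(σ ^ 2 * r ^ 2 * (x * q) ^ 2) - x * q * Y - 4 * x * x' * p * L := by
    rw [hY, hLdef]; ring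
  rw [key]
  linarith

theorem integral_dirichlet_deriv_le (hP : IsCompleteSolution σ α β 1 T P) (hσ : 0 < σ)
    (hα : 0 < α) :
    ∃ C, 0 ≤ C ∧ ∀ τ ∈ Ioo 0 T, ∀ a b, 1 ≤ a → a ≤ b → ∀ η η' : ℝ → ℝ,
      Continuous η → Continuous η' →
      (∀ r ∈ Icc a b, |η r| ≤ 3) → (∀ r ∈ Icc a b, |η' r| ≤ 3) →
      ∫ r in a..b, -pTau P τ r * (2 * (2 * η r * η' r) * pR P τ r + 2 * η r ^ 2 * pRR P τ r) ≤
        ∫ r in a..b, C * r ^ 2 * (pR P τ r ^ 2 + P τ r ^ 2) := by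
  set k := α + |β| with hk
  have hk0 : 0 < k := by positivity
  refine ⟨18 * ((k + σ ^ 2) ^ 2 + 1) / σ ^ 2 + 36 * (k + 1), by positivity, ?_⟩
  intro τ hτ a b ha hab η η' hη hη' bη bη'
  obtain ⟨c0, c1, c2, c3⟩ := hP.continuousOn_uIcc hτ (by linarith) hab
  refine intervalIntegral.integral_mono_on hab (ContinuousOn.intervalIntegrable (by fun_prop))
    (ContinuousOn.intervalIntegrable (by fun_prop)) fun r hr => ?_
  have hr1 : 1 ≤ r := ha.trans hr.1
  rw [hP.pTau_eq hτ (by linarith)]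
  exact dirichlet_integrand_le hσ hα hk hr1 (bη r hr) (bη' r hr)

theorem dirichlet_tail_le (hP : IsCompleteSolution σ α β 1 T P) (hσ : 0 < σ) (hα : 0 < α)
    (hT : 0 < T) :
    ∃ C, 0 ≤ C ∧ ∀ s ∈ Ioo 0 T, ∀ t ∈ Ioo 0 T, s ≤ t → ∀ a, 1 ≤ a →
      (t - s) * ∫ r in (a + 1)..(a + 2), pR P t r ^ 2 ≤ C / a ^ 6 := by
  obtain ⟨M, hM, hdec⟩ := hP.exists_decay
  obtain ⟨C₂, hC₂, hdir⟩ := hP.integral_dirichlet_deriv_le hσ hα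
  set C₁ := 2 * (α + |β| + σ ^ 2) ^ 2 / σ ^ 2 with hC₁
  have hC₁0 : 0 ≤ C₁ := by positivity
  set Λ := 2 * (9 + T * C₂) / σ ^ 2 with hΛ
  have hΛ0 : 0 ≤ Λ := by positivity
  have hΛσ : Λ * (1 / 2 * σ ^ 2) = 9 + T * C₂ := by rw [hΛ]; field_simp
  set V := 3 * (T * C₂ + Λ * C₁) + 2 * Λ * σ ^ 2 with hV
  have hV0 : 0 ≤ V := by positivity
  refine ⟨(3 * Λ + V * T) * M ^ 2, by positivity, ?_⟩
  intro s hs t ht hst a ha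
  set N := M ^ 2 / a ^ 6 with hN
  have hN0 : 0 ≤ N := by positivity
  have hdecay : ∀ τ ∈ Ioo 0 T, ∀ r, a ≤ r → ∀ X, |X| ≤ M → r ^ 2 * (|P τ r| * |X|) ≤ N := by
    intro τ hτ r hr X hX
    have hr0 : 0 < r := by linarith
    have h₁ := (hdec τ hτ r hr0).2.1
    rw [hN, le_div_iff₀ (by positivity)]
    calc r ^ 2 * (|P τ r| * |X|) * a ^ 6 ≤ r ^ 2 * (|P τ r| * |X|) * r ^ 6 := by gcongr
      _ = (r ^ 8 * |P τ r|) * |X| := by ring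
      _ ≤ M * M := by gcongr
      _ = M ^ 2 := by ring
  have hsqle : ∀ τ ∈ Ioo 0 T, ∀ r, a ≤ r → r ^ 2 * P τ r ^ 2 ≤ N := by
    intro τ hτ r hr
    have := hdecay τ hτ r hr (P τ r) (hdec τ hτ r (by linarith)).1
    rwa [← sq, sq_abs] at this
  have hsqle' : ∀ τ ∈ Ioo 0 T, ∀ r, a ≤ r → P τ r ^ 2 ≤ N := fun τ hτ r hr =>
    (le_mul_of_one_le_left (sq_nonneg _) (one_le_pow₀ (ha.trans hr))).trans (hsqle τ hτ r hr)
  have hflux : ∀ τ ∈ Ioo 0 T, ∀ r, a ≤ r → |σ ^ 2 * r ^ 2 * P τ r * pR P τ r| ≤ σ ^ 2 * N := by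
    intro τ hτ r hr
    have := hdecay τ hτ r hr (pR P τ r) (hdec τ hτ r (by linarith)).2.2
    calc _ = σ ^ 2 * (r ^ 2 * (|P τ r| * |pR P τ r|)) := by
          rw [abs_mul, abs_mul, abs_of_nonneg (by positivity : 0 ≤ σ ^ 2 * r ^ 2)]; ring
      _ ≤ _ := by gcongr
  set b := a + 3 with hb
  have hab : a ≤ b := by linarith
  set η : ℝ → ℝ := fun r => (r - a) * (b - r) with hη
  set η' : ℝ → ℝ := fun r => (b - r) - (r - a) with hη'
  have hηc : Continuous η := by fun_prop
  have hηc' : Continuous η' := by fun_prop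
  have hηb : ∀ r ∈ Icc a b, |η r| ≤ 3 := by
    intro r hr
    have h₁ : 0 ≤ r - a := by linarith [hr.1]
    have h₂ : 0 ≤ b - r := by linarith [hr.2]
    simp only [hη]
    rw [abs_of_nonneg (mul_nonneg h₁ h₂)]
    nlinarith [sq_nonneg ((r - a) - (b - r))]
  have hηb' : ∀ r ∈ Icc a b, |η' r| ≤ 3 := by
    intro r hr
    simp only [hη']
    rw [abs_le]
    constructor <;> linarith [hr.1, hr.2]
  have hηd : ∀ r, HasDerivAt (fun x => η x ^ 2) (2 * η r * η' r) r := by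
    intro r
    convert! (((hasDerivAt_id r).sub_const a).mul ((hasDerivAt_id r).const_sub b)).pow 2 using 1
    simp only [hη, hη', id, Pi.mul_apply]
    push_cast
    ring
  set I : ℝ → ℝ := fun τ => ∫ r in a..b, η r ^ 2 * pR P τ r ^ 2 with hI
  set J : ℝ → ℝ := fun τ => ∫ r in a..b, 1 * P τ r ^ 2 with hJ
  have hId : ∀ τ ∈ Ioo 0 T, HasDerivAt I (∫ r in a..b, -pTau P τ r *
      (2 * (2 * η r * η' r) * pR P τ r + 2 * η r ^ 2 * pRR P τ r)) τ := fun τ hτ =>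
    hP.hasDerivAt_integral_pR_sq hτ (by linarith) hab hηd (by fun_prop) (by simp [hη])
      (by simp [hη])
  have hJd : ∀ τ ∈ Ioo 0 T, HasDerivAt J (∫ r in a..b, 1 * (2 * P τ r * pTau P τ r)) τ :=
    fun τ hτ => hP.hasDerivAt_integral_sq (w := fun _ => 1) hτ (by linarith) hab
      continuous_const
  have hFd : ∀ τ ∈ Ioo 0 T, HasDerivAt (fun x => (x - s) * I x + Λ * J x)
      (1 * I τ + (τ - s) * (∫ r in a..b, -pTau P τ r *
      (2 * (2 * η r * η' r) * pR P τ r + 2 * η r ^ 2 * pRR P τ r)) +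
      Λ * ∫ r in a..b, 1 * (2 * P τ r * pTau P τ r)) τ := fun τ hτ =>
    (((hasDerivAt_id τ).sub_const s).mul (hId τ hτ)).add ((hJd τ hτ).const_mul Λ)
  have hmem : ∀ τ ∈ Icc s t, τ ∈ Ioo 0 T := fun τ hτ =>
    ⟨hs.1.trans_le hτ.1, hτ.2.trans_lt ht.2⟩
  have hderiv : ∀ τ ∈ Icc s t, 1 * I τ + (τ - s) * (∫ r in a..b, -pTau P τ r *
      (2 * (2 * η r * η' r) * pR P τ r + 2 * η r ^ 2 * pRR P τ r)) +
      Λ * (∫ r in a..b, 1 * (2 * P τ r * pTau P τ r)) ≤ V * N := by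
    intro τ hτ
    have hτ' := hmem τ hτ
    obtain ⟨c0, c1, c2, c3⟩ := hP.continuousOn_uIcc hτ' (by linarith) hab
    have hτs : 0 ≤ τ - s := by linarith [hτ.1]
    have hτT : τ - s ≤ T := by linarith [hs.1, hτ'.2]
    have e₁ : (τ - s) * (∫ r in a..b, -pTau P τ r *
        (2 * (2 * η r * η' r) * pR P τ r + 2 * η r ^ 2 * pRR P τ r)) ≤
        T * ∫ r in a..b, C₂ * r ^ 2 * (pR P τ r ^ 2 + P τ r ^ 2) := by
      refine (mul_le_mul_of_nonneg_left (hdir τ hτ' a b ha hab η η' hηc hηc' hηb hηb') hτs).trans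
        (mul_le_mul_of_nonneg_right hτT ?_)
      exact intervalIntegral.integral_nonneg hab fun r _ => by positivity
    have e₂ := mul_le_mul_of_nonneg_left (hP.integral_sq_parts_le hσ hα hτ' ha hab) hΛ0
    have e₃ := abs_le.1 (hflux τ hτ' a le_rfl)
    have e₄ := abs_le.1 (hflux τ hτ' b hab)
    have e₅ : I τ + T * (∫ r in a..b, C₂ * r ^ 2 * (pR P τ r ^ 2 + P τ r ^ 2)) +
        Λ * (∫ r in a..b, (C₁ * P τ r ^ 2 - 1 / 2 * σ ^ 2 * r ^ 2 * pR P τ r ^ 2)) ≤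
        3 * (T * C₂ + Λ * C₁) * N := by
      rw [hI, ← intervalIntegral.integral_const_mul, ← intervalIntegral.integral_const_mul,
        ← intervalIntegral.integral_add (ContinuousOn.intervalIntegrable (by fun_prop))
          (ContinuousOn.intervalIntegrable (by fun_prop)),
        ← intervalIntegral.integral_add (ContinuousOn.intervalIntegrable (by fun_prop))
          (ContinuousOn.intervalIntegrable (by fun_prop))]
      have hconst : 3 * (T * C₂ + Λ * C₁) * N = ∫ _ in a..b, (T * C₂ + Λ * C₁) * N := by
        rw [intervalIntegral.integral_const, hb, smul_eq_mul]; ring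
      rw [hconst]
      refine intervalIntegral.integral_mono_on hab (ContinuousOn.intervalIntegrable (by fun_prop))
        (by simp) fun r hr => ?_
      have k₁ := hsqle τ hτ' r hr.1
      have k₂ := hsqle' τ hτ' r hr.1
      have k₃ : η r ^ 2 * pR P τ r ^ 2 ≤ 9 * (r ^ 2 * pR P τ r ^ 2) := by
        have h₁ : η r ^ 2 ≤ 3 ^ 2 := by rw [← sq_abs]; gcongr; exact hηb r hr
        have h₂ : 1 ≤ r ^ 2 := one_le_pow₀ (ha.trans hr.1)
        have h₃ := mul_le_mul_of_nonneg_right h₁ (sq_nonneg (pR P τ r))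
        have h₄ := mul_le_mul_of_nonneg_right h₂ (sq_nonneg (pR P τ r))
        linarith
      have k₄ : Λ * (1 / 2 * σ ^ 2) * (r ^ 2 * pR P τ r ^ 2) =
          (9 + T * C₂) * (r ^ 2 * pR P τ r ^ 2) := by rw [hΛσ]
      have k₅ := mul_le_mul_of_nonneg_left k₁ (by positivity : 0 ≤ T * C₂)
      have k₆ := mul_le_mul_of_nonneg_left k₂ (by positivity : 0 ≤ Λ * C₁)
      linarith
    have e₆ : Λ * (σ ^ 2 * b ^ 2 * P τ b * pR P τ b - σ ^ 2 * a ^ 2 * P τ a * pR P τ a) ≤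
        Λ * (2 * σ ^ 2 * N) := mul_le_mul_of_nonneg_left (by linarith) hΛ0
    rw [hV]
    linarith
  have hcont : ContinuousOn (fun x => (x - s) * I x + Λ * J x) (Icc s t) := fun τ hτ =>
    (hFd τ (hmem τ hτ)).continuousAt.continuousWithinAt
  have hJs : J s ≤ 3 * N := by
    obtain ⟨c0, -⟩ := hP.continuousOn_uIcc hs (by linarith) hab
    have hconst : 3 * N = ∫ _ in a..b, N := by
      rw [intervalIntegral.integral_const, hb, smul_eq_mul]; ring
    rw [hJ, hconst]
    refine intervalIntegral.integral_mono_on hab (ContinuousOn.intervalIntegrable (by fun_prop))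
      (by simp) fun r hr => ?_
    rw [one_mul]
    exact hsqle' s hs r hr.1
  have hfinal := image_le_of_deriv_right_le_deriv_boundary
    (B := fun x => Λ * (3 * N) + V * N * (x - s))
    (B' := fun _ => V * N) hcont
    (fun x hx => (hFd x (hmem x (Ico_subset_Icc_self hx))).hasDerivWithinAt)
    (by simpa using mul_le_mul_of_nonneg_left hJs hΛ0) (by fun_prop)
    (fun x _ => by
      have := (((hasDerivAt_id x).sub_const s).const_mul (V * N)).const_add (Λ * (3 * N))
      simpa using this.hasDerivWithinAt)
    (fun x hx => hderiv x (Ico_subset_Icc_self hx)) (right_mem_Icc.2 hst)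
  have hJt : 0 ≤ J t := intervalIntegral.integral_nonneg hab fun r _ => by positivity
  obtain ⟨-, c1, -⟩ := hP.continuousOn_uIcc ht (by linarith) hab
  have hsubI : ∫ r in (a + 1)..(a + 2), pR P t r ^ 2 ≤ I t := by
    have hsub : uIcc (a + 1) (a + 2) ⊆ uIcc a b := by
      rw [uIcc_of_le hab, uIcc_of_le (by linarith)]
      exact Icc_subset_Icc (by linarith) (by linarith)
    have c1' := c1.mono hsub
    calc ∫ r in (a + 1)..(a + 2), pR P t r ^ 2
        ≤ ∫ r in (a + 1)..(a + 2), η r ^ 2 * pR P t r ^ 2 := by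
          refine intervalIntegral.integral_mono_on (by linarith)
            (ContinuousOn.intervalIntegrable (by fun_prop))
            (ContinuousOn.intervalIntegrable (by fun_prop)) fun r hr => ?_
          have : 1 ≤ η r := by simp only [hη, hb]; nlinarith [hr.1, hr.2]
          exact le_mul_of_one_le_left (sq_nonneg _) (one_le_pow₀ this)
      _ ≤ I t := intervalIntegral.integral_mono_interval (by linarith) (by linarith)
          (by linarith) (Eventually.of_forall fun r => by simp only [Pi.zero_apply]; positivity)
          (ContinuousOn.intervalIntegrable (by fun_prop))
  have hts : 0 ≤ t - s := by linarith
  have htT : t - s ≤ T := by linarith [hs.1, ht.2]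
  calc (t - s) * ∫ r in (a + 1)..(a + 2), pR P t r ^ 2 ≤ (t - s) * I t := by gcongr
    _ ≤ Λ * (3 * N) + V * N * (t - s) := by
        have := mul_nonneg hΛ0 hJt
        linarith
    _ ≤ Λ * (3 * N) + V * N * T := by gcongr
    _ = _ := by rw [hN]; ring

theorem energyFlux_energyDensity_le (hP : IsCompleteSolution σ α β γ T P) :
    ∃ C, 0 ≤ C ∧ ∀ t ∈ Ioo 0 T, ∀ a r, 1 ≤ a → a ≤ r →
      |energyFlux σ α β P t r| ≤ C / a ^ 2 ∧
      |energyDensity σ α β P t r + σ ^ 2 * r ^ 4 * pR P t r ^ 2| ≤ C / a ^ 2 := by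
  obtain ⟨M, hM, hdec⟩ := hP.exists_decay
  set K₁ := 3 * σ ^ 2 + |α| + |β| with hK₁
  set K₂ := 6 * σ ^ 2 + 3 * |β| + 2 * |α| + 2 with hK₂
  refine ⟨(K₁ + K₂) * M ^ 2, by positivity, ?_⟩
  intro t ht a r ha har
  have hr1 : 1 ≤ r := ha.trans har
  have hr0 : 0 < r := by linarith
  obtain ⟨h₁, h₂, h₃⟩ := hdec t ht r hr0
  have ha0 : 0 < a := by linarith
  set N := M ^ 2 / a ^ 2 with hN
  have hN0 : 0 ≤ N := by positivity
  have hdecay : ∀ j ≤ 6, ∀ X, |X| ≤ M → |r ^ j * (P t r * X)| ≤ N := by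
    intro j hj X hX
    rw [abs_mul, abs_mul, abs_of_pos (by positivity : 0 < r ^ j), hN,
      le_div_iff₀ (by positivity)]
    calc r ^ j * (|P t r| * |X|) * a ^ 2 ≤ r ^ 6 * (|P t r| * |X|) * r ^ 2 := by gcongr
      _ = (r ^ 8 * |P t r|) * |X| := by ring
      _ ≤ M * M := by gcongr
      _ = M ^ 2 := by ring
  have d1 := hdecay 4 (by norm_num) _ h₃
  have d2 := hdecay 3 (by norm_num) _ h₁
  have d3 := hdecay 2 (by norm_num) _ h₁
  have d4 := hdecay 1 (by norm_num) _ h₁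
  have hscale : ∀ c X : ℝ, |X| ≤ N → |c * X| ≤ |c| * N := fun c X hX => by
    rw [abs_mul]; gcongr
  have hσ2 : |σ ^ 2| = σ ^ 2 := abs_of_nonneg (sq_nonneg σ)
  have f1 := abs_le.1 (hscale (σ ^ 2) _ d1)
  have f2 := abs_le.1 (hscale (σ ^ 2) _ d2)
  have f3 := abs_le.1 (hscale α _ d3)
  have f4 := abs_le.1 (hscale β _ d2)
  have f5 := abs_le.1 (hscale (σ ^ 2) _ d3)
  have f6 := abs_le.1 (hscale β _ d3)
  have f7 := abs_le.1 (hscale α _ d4)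
  have f8 := abs_le.1 d2
  rw [hσ2] at f1 f2 f5
  have g1 : 0 ≤ K₁ * N := by positivity
  have g2 : 0 ≤ K₂ * N := by positivity
  have hKN : (K₁ + K₂) * M ^ 2 / a ^ 2 = K₁ * N + K₂ * N := by rw [hN]; ring
  rw [hKN]
  constructor
  · have : |energyFlux σ α β P t r| ≤ K₁ * N := by
      rw [abs_le, energyFlux, hK₁]
      constructor <;> linarith
    linarith
  · have : |energyDensity σ α β P t r + σ ^ 2 * r ^ 4 * pR P t r ^ 2| ≤ K₂ * N := by
      rw [abs_le, energyDensity, hK₂]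
      constructor <;> linarith
    linarith

/-- The energy rates on the unit intervals are summable, locally uniformly in time. -/
theorem integral_energy_deriv_tail (hP : IsCompleteSolution σ α β 1 T P) (hσ : 0 < σ)
    (hα : 0 < α) (hT : 0 < T) {s t₀ : ℝ} (hs : 0 < s) (hst : s < t₀) :
    ∃ C, ∀ t ∈ Ioo t₀ T, ∀ a, 1 ≤ a →
      |∫ r in (a + 1)..(a + 2), r ^ 2 * (2 * P t r * pTau P t r)| ≤ C / a ^ 2 := by
  obtain ⟨C₁, hC₁, hflux⟩ := hP.energyFlux_energyDensity_le
  obtain ⟨C₂, hC₂, htail⟩ := hP.dirichlet_tail_le hσ hα hT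
  have hd : 0 < t₀ - s := by linarith
  refine ⟨3 * C₁ + 81 * σ ^ 2 * (C₂ / (t₀ - s)), fun t ht a ha => ?_⟩
  have ht' : t ∈ Ioo 0 T := ⟨by linarith [ht.1], ht.2⟩
  have hs' : s ∈ Ioo 0 T := ⟨hs, by linarith [ht.1, ht.2]⟩
  have ha0 : 0 < a := by linarith
  have hab : a + 1 ≤ a + 2 := by linarith
  obtain ⟨c0, c1, -, -⟩ := hP.continuousOn_uIcc ht' (by linarith) hab
  have hD : ∫ r in (a + 1)..(a + 2), pR P t r ^ 2 ≤ C₂ / (t₀ - s) / a ^ 6 := by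
    have h₁ := htail s hs' t ht' (by linarith [ht.1]) a ha
    have h₂ : 0 ≤ ∫ r in (a + 1)..(a + 2), pR P t r ^ 2 :=
      intervalIntegral.integral_nonneg hab fun r _ => sq_nonneg _
    rw [div_div, mul_comm (t₀ - s), ← div_div, le_div_iff₀ hd]
    have := mul_le_mul_of_nonneg_right (by linarith [ht.1] : t₀ - s ≤ t - s) h₂
    linarith
  rw [hP.integral_energy_parts ht' (by linarith) hab]
  have f₁ := (hflux t ht' a (a + 1) ha (by linarith)).1
  have f₂ := (hflux t ht' a (a + 2) ha (by linarith)).1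
  have hI : ‖∫ r in (a + 1)..(a + 2), energyDensity σ α β P t r‖ ≤
      ∫ r in (a + 1)..(a + 2), (C₁ / a ^ 2 + 81 * σ ^ 2 * a ^ 4 * pR P t r ^ 2) := by
    refine intervalIntegral.norm_integral_le_of_norm_le hab ?_
      (ContinuousOn.intervalIntegrable (by fun_prop))
    refine Eventually.of_forall fun r hr => ?_
    have h₁ := (hflux t ht' a r ha (by linarith [hr.1])).2
    have h₂ : σ ^ 2 * r ^ 4 * pR P t r ^ 2 ≤ 81 * σ ^ 2 * a ^ 4 * pR P t r ^ 2 := by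
      have : r ^ 4 ≤ (3 * a) ^ 4 := by
        gcongr
        · linarith [hr.1]
        · linarith [hr.2]
      calc _ ≤ σ ^ 2 * (3 * a) ^ 4 * pR P t r ^ 2 := by gcongr
        _ = _ := by ring
    have h₃ : 0 ≤ σ ^ 2 * r ^ 4 * pR P t r ^ 2 := by
      have : 0 < r := by linarith [hr.1]
      positivity
    rw [Real.norm_eq_abs]
    rw [abs_le] at h₁ ⊢
    constructor <;> linarith
  rw [intervalIntegral.integral_add (by simp) (ContinuousOn.intervalIntegrable (by fun_prop)),
    intervalIntegral.integral_const, intervalIntegral.integral_const_mul, smul_eq_mul,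
    Real.norm_eq_abs] at hI
  have hlast : 81 * σ ^ 2 * a ^ 4 * (∫ r in (a + 1)..(a + 2), pR P t r ^ 2) ≤
      81 * σ ^ 2 * (C₂ / (t₀ - s)) / a ^ 2 := by
    calc _ ≤ 81 * σ ^ 2 * a ^ 4 * (C₂ / (t₀ - s) / a ^ 6) := by gcongr
      _ = _ := by field_simp
  have hsplit : (3 * C₁ + 81 * σ ^ 2 * (C₂ / (t₀ - s))) / a ^ 2 =
      3 * (C₁ / a ^ 2) + 81 * σ ^ 2 * (C₂ / (t₀ - s)) / a ^ 2 := by ring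
  rw [hsplit]
  rw [abs_le] at f₁ f₂ hI ⊢
  constructor <;> linarith

theorem integrableOn_energy (hP : IsCompleteSolution σ α β γ T P) {t : ℝ} (ht : t ∈ Ioo 0 T) :
    IntegrableOn (fun r => r ^ 2 * P t r ^ 2) (Ioi 0) := by
  obtain ⟨M, hM, hdec⟩ := hP.exists_decay
  refine Integrable.mono' (integrable_inv_one_add_sq.const_mul (2 * M ^ 2)).integrableOn
    ((ContinuousOn.mul (by fun_prop) (((hP.continuousOn_slice ht).mono
      Ioi_subset_Ici_self).pow 2)).aestronglyMeasurable measurableSet_Ioi) ?_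
  refine (ae_restrict_mem measurableSet_Ioi).mono fun r hr => ?_
  have hr0 : 0 < r := hr
  obtain ⟨h₁, h₂, -⟩ := hdec t ht r hr0
  rw [Real.norm_eq_abs, abs_of_nonneg (by positivity), ← div_eq_mul_inv,
    le_div_iff₀ (by positivity), ← sq_abs (P t r)]
  have h₀ := abs_nonneg (P t r)
  have hk : ∀ j ≤ 8, r ^ j * |P t r| ≤ M := by
    intro j hj
    rcases le_total r 1 with h | h
    · exact (mul_le_of_le_one_left h₀ (pow_le_one₀ hr0.le h)).trans h₁
    · refine le_trans ?_ h₂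
      gcongr
  have e₁ : r ^ 2 * |P t r| * |P t r| ≤ M * M := by gcongr; exact hk 2 (by norm_num)
  have e₂ : r ^ 4 * |P t r| * |P t r| ≤ M * M := by gcongr; exact hk 4 (by norm_num)
  linarith

end IsCompleteSolution

/-- for `γ = 1` any complete solution satisfies
`d/dτ ∫₀^∞ r² P² ≤ K ∫₀^∞ r² P²` with `K = 3(2σ² - β)`. -/
theorem energy_inequality_gamma_one (σ α β T : ℝ) (hσ : 0 < σ) (hα : 0 < α)
    (hT : 0 < T) (P : ℝ → ℝ → ℝ) (hP : IsCompleteSolution σ α β 1 T P) :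
    ∀ τ ∈ Ioo (0:ℝ) T, ∃ D : ℝ,
      HasDerivAt (fun t => ∫ r in Ioi (0:ℝ), r^2 * (P t r)^2) D τ ∧
      D ≤ (3*(2*σ^2 - β)) * ∫ r in Ioi (0:ℝ), r^2 * (P τ r)^2 := by
  intro τ hτ
  obtain ⟨C, htail⟩ := hP.integral_energy_deriv_tail hσ hα hT (s := τ / 3) (t₀ := τ / 2)
    (by linarith [hτ.1]) (by linarith [hτ.1])
  have hmem : ∀ t ∈ Ioo (τ / 2) T, t ∈ Ioo 0 T := fun t ht => ⟨by linarith [hτ.1, ht.1], ht.2⟩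
  have hτ' : τ ∈ Ioo (τ / 2) T := ⟨by linarith [hτ.1], hτ.2⟩
  set e : ℕ → ℝ → ℝ := fun n t => ∫ r in ((n : ℝ) + 1 + 1)..((n : ℝ) + 1 + 2), r ^ 2 * P t r ^ 2
    with he
  set e' : ℕ → ℝ → ℝ := fun n t =>
    ∫ r in ((n : ℝ) + 1 + 1)..((n : ℝ) + 1 + 2), r ^ 2 * (2 * P t r * pTau P t r) with he'
  have hint : ∀ t ∈ Ioo 0 T, ∀ a b, 0 ≤ a → a ≤ b →
      IntervalIntegrable (fun r => r ^ 2 * P t r ^ 2) volume a b := fun t ht a b ha hab => by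
    obtain ⟨c0, -⟩ := hP.continuousOn_uIcc ht ha hab
    exact ContinuousOn.intervalIntegrable (by fun_prop)
  have hint' : ∀ a b, 0 ≤ a → a ≤ b →
      IntervalIntegrable (fun r => r ^ 2 * (2 * P τ r * pTau P τ r)) volume a b :=
    fun a b ha hab => by
      obtain ⟨c0, -, -, c3⟩ := hP.continuousOn_uIcc hτ ha hab
      exact ContinuousOn.intervalIntegrable (by fun_prop)
  have hsum : ∀ f : ℝ → ℝ, (∀ a b, 0 ≤ a → a ≤ b → IntervalIntegrable f volume a b) → ∀ N : ℕ,
      (∫ r in (0 : ℝ)..2, f r) + ∑ n ∈ Finset.range N,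
        (∫ r in ((n : ℝ) + 1 + 1)..((n : ℝ) + 1 + 2), f r) = ∫ r in (0 : ℝ)..(N + 2), f r := by
    intro f hf N
    have h := intervalIntegral.sum_integral_adjacent_intervals (μ := volume) (f := f)
      (a := fun n : ℕ => (n : ℝ) + 2) (n := N)
      fun k _ => hf _ _ (by positivity) (by push_cast; linarith)
    have h' : ∑ n ∈ Finset.range N, (∫ r in ((n : ℝ) + 1 + 1)..((n : ℝ) + 1 + 2), f r) =
        ∫ r in (2 : ℝ)..(N + 2), f r := by
      rw [Nat.cast_zero, zero_add] at h
      rw [← h]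
      refine Finset.sum_congr rfl fun n _ => ?_
      rw [Nat.cast_succ, add_assoc (n : ℝ) 1 1, one_add_one_eq_two]
    rw [h']
    exact intervalIntegral.integral_add_adjacent_intervals (hf _ _ le_rfl (by norm_num))
      (hf _ _ (by norm_num) (by have : (0 : ℝ) ≤ N := by positivity
                                linarith))
  have hatTop : Tendsto (fun N : ℕ => (N : ℝ) + 2) atTop atTop :=
    tendsto_atTop_add_const_right _ _ tendsto_natCast_atTop_atTop
  have hlim : ∀ t ∈ Ioo 0 T, Tendsto (fun N : ℕ => ∫ r in (0 : ℝ)..(N + 2), r ^ 2 * P t r ^ 2)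
      atTop (𝓝 (∫ r in Ioi (0 : ℝ), r ^ 2 * P t r ^ 2)) := fun t ht =>
    intervalIntegral_tendsto_integral_Ioi 0 (hP.integrableOn_energy ht) hatTop
  have hhas : ∀ t ∈ Ioo 0 T, HasSum (fun n => e n t)
      ((∫ r in Ioi (0 : ℝ), r ^ 2 * P t r ^ 2) - ∫ r in (0 : ℝ)..2, r ^ 2 * P t r ^ 2) := by
    intro t ht
    rw [hasSum_iff_tendsto_nat_of_nonneg fun n => intervalIntegral.integral_nonneg (by linarith)
      fun r _ => by positivity]
    refine ((hlim t ht).sub_const _).congr fun N => ?_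
    rw [← hsum _ (hint t ht) N]
    ring
  have hu : Summable fun n : ℕ => C / ((n : ℝ) + 1) ^ 2 := by
    have h := (summable_nat_add_iff 1).2 (Real.summable_one_div_nat_pow.2 one_lt_two)
    refine (h.mul_left C).congr fun n => ?_
    push_cast
    ring
  have hbound : ∀ n : ℕ, ∀ t ∈ Ioo (τ / 2) T, ‖e' n t‖ ≤ C / ((n : ℝ) + 1) ^ 2 := fun n t ht =>
    htail t ht (n + 1) (by linarith [(Nat.cast_nonneg n : (0 : ℝ) ≤ n)])
  have hderiv := hasDerivAt_tsum_of_isPreconnected hu isOpen_Ioo isPreconnected_Ioo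
    (fun n t ht => hP.hasDerivAt_integral_sq (a := (n : ℝ) + 1 + 1) (b := (n : ℝ) + 1 + 2)
      (hmem t ht) (by positivity) (by linarith) (continuous_pow 2))
    hbound hτ' (hhas τ hτ).summable hτ'
  have hderiv₀ := hP.hasDerivAt_integral_sq (a := 0) (b := 2) hτ le_rfl (by norm_num)
    (continuous_pow 2)
  refine ⟨(∫ r in (0 : ℝ)..2, r ^ 2 * (2 * P τ r * pTau P τ r)) + ∑' n, e' n τ,
    (hderiv₀.add hderiv).congr_of_eventuallyEq ?_, ?_⟩
  · filter_upwards [isOpen_Ioo.mem_nhds hτ] with t ht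
    have := (hhas t ht).tsum_eq
    simp only [he] at this
    simp only [Pi.add_apply]
    rw [this]
    ring
  · obtain ⟨C₁, -, hflux⟩ := hP.energyFlux_energyDensity_le
    have hl : Tendsto (fun N : ℕ => (∫ r in (0 : ℝ)..2, r ^ 2 * (2 * P τ r * pTau P τ r)) +
        ∑ n ∈ Finset.range N, e' n τ) atTop (𝓝 ((∫ r in (0 : ℝ)..2,
          r ^ 2 * (2 * P τ r * pTau P τ r)) + ∑' n, e' n τ)) :=
      (Summable.of_norm_bounded hu fun n => hbound n τ hτ').hasSum.tendsto_sum_nat.const_add _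
    have hr : Tendsto (fun N : ℕ => C₁ / ((N : ℝ) + 2) ^ 2 +
        (3 * (2 * σ ^ 2 - β)) * ∫ r in (0 : ℝ)..(N + 2), r ^ 2 * P τ r ^ 2) atTop
        (𝓝 (0 + (3 * (2 * σ ^ 2 - β)) * ∫ r in Ioi (0 : ℝ), r ^ 2 * P τ r ^ 2)) :=
      (((tendsto_pow_atTop two_ne_zero).comp hatTop).const_div_atTop C₁).add
        ((hlim τ hτ).const_mul _)
    rw [zero_add] at hr
    refine le_of_tendsto_of_tendsto' hl hr fun N => ?_
    have hN : (0 : ℝ) ≤ N + 2 := by positivity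
    have hN1 : (1 : ℝ) ≤ N + 2 := by linarith [(Nat.cast_nonneg N : (0 : ℝ) ≤ N)]
    obtain ⟨c0, c1, -, -⟩ := hP.continuousOn_uIcc hτ le_rfl hN
    simp only [he']
    rw [hsum _ hint' N, hP.integral_energy_parts hτ le_rfl hN]
    have h₀ : energyFlux σ α β P τ 0 = 0 := by simp [energyFlux]
    have h₁ := (abs_le.1 (hflux τ hτ _ _ hN1 le_rfl).1).2
    have h₂ : ∫ r in (0 : ℝ)..(N + 2), energyDensity σ α β P τ r ≤
        (3 * (2 * σ ^ 2 - β)) * ∫ r in (0 : ℝ)..(N + 2), r ^ 2 * P τ r ^ 2 := by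
      rw [← intervalIntegral.integral_const_mul]
      refine intervalIntegral.integral_mono_on hN
        (ContinuousOn.intervalIntegrable (by unfold energyDensity; fun_prop))
        ((hint τ hτ _ _ le_rfl hN).const_mul _) fun r hr => ?_
      have hr0 : 0 ≤ r := hr.1
      have p₁ : 0 ≤ σ ^ 2 * r ^ 4 * pR P τ r ^ 2 := by positivity
      have p₂ : 0 ≤ 2 * α * r * P τ r ^ 2 := by positivity
      have p₃ : 0 ≤ 2 * r ^ 3 * P τ r ^ 2 := by positivity
      rw [energyDensity]
      linarith
    linarith
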